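/- For c ≥ 0, the infinitesimal shift ∂_c is an unbounded normal operator on ℍ_c = L²(ℝ, e^{-2ct}dt), and its adjoint is given by ∂_c* = 2c − ∂_c with D(∂_c*) = D(∂_c). -/

import Mathlib

open MeasureTheory Complex

/-- The weighted Hilbert space measure `μ_c(dt) = e^{-2ct} dt` on `ℝ`;
`ℍ_c = L²(ℝ, μ_c)` is then `Lp ℂ 2 (weightedMeasure c)`. -/
noncomputable def weightedMeasure (c : ℝ) : Measure ℝ :=
  volume.withDensity fun t => ENNReal.ofReal (Real.exp (-2 * c * t))

/-- `A` is the infinitesimal shift `∂_c` on `ℍ_c`: it is densely defined, its domain is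
`{f ∈ ℍ_c ∩ AC(ℝ) : f' ∈ ℍ_c}`, and it maps `f` to `f'`.  Membership of `(f, g)` in the
graph of `A` is characterized by: `f` has an absolutely continuous representative `F` with
`F(t) = F(s) + ∫_s^t g(u) du` for all `s, t` (i.e. `F' = g` a.e., `g ∈ ℍ_c`). -/
def IsInfinitesimalShift (c : ℝ)
    (A : Lp ℂ 2 (weightedMeasure c) →ₗ.[ℂ] Lp ℂ 2 (weightedMeasure c)) : Prop :=
  Dense (A.domain : Set (Lp ℂ 2 (weightedMeasure c))) ∧
  ∀ f g : Lp ℂ 2 (weightedMeasure c),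
    (∃ hf : f ∈ A.domain, A ⟨f, hf⟩ = g) ↔
      ∃ F : ℝ → ℂ, (⇑f : ℝ → ℂ) =ᵐ[weightedMeasure c] F ∧
        ∀ s t : ℝ, F t = F s + ∫ u in s..t, (g : ℝ → ℂ) u

section

open Set Filter Topology
open scoped ContDiff ComplexConjugate

/-- `F` is an indefinite Lebesgue integral of the locally integrable function `f`. -/
structure IsPrimitive (F f : ℝ → ℂ) : Prop where
  locallyIntegrable : LocallyIntegrable f volume
  eq_add_integral : ∀ s t : ℝ, F t = F s + ∫ u in s..t, f u

theorem MeasureTheory.LocallyIntegrable.intervalIntegrable_real {f : ℝ → ℂ}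
    (hf : LocallyIntegrable f volume) (a b : ℝ) : IntervalIntegrable f volume a b :=
  intervalIntegrable_iff.mpr <|
    (hf.integrableOn_isCompact isCompact_uIcc).mono_set uIoc_subset_uIcc

theorem MeasureTheory.LocallyIntegrable.conj {f : ℝ → ℂ} (hf : LocallyIntegrable f volume) :
    LocallyIntegrable (fun t => conj (f t)) volume :=
  locallyIntegrable_iff.mpr fun _ hK =>
    (Complex.conjCLE.toContinuousLinearMap.integrable_comp (hf.integrableOn_isCompact hK))

theorem IntervalIntegrable.absolutelyContinuousOnInterval_intervalIntegral_complex {f : ℝ → ℂ}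
    {a b : ℝ} (hf : IntervalIntegrable f volume a b) :
    AbsolutelyContinuousOnInterval (fun x => ∫ u in a..x, f u) a b := by
  have hre : IntervalIntegrable (fun u => (f u).re) volume a b := ⟨hf.1.re, hf.2.re⟩
  have him : IntervalIntegrable (fun u => (f u).im) volume a b := ⟨hf.1.im, hf.2.im⟩
  have hc (z : ℂ) : AbsolutelyContinuousOnInterval (fun _ : ℝ => z) a b :=
    contDiffOn_const.absolutelyContinuousOnInterval
  have h := ((hre.absolutelyContinuousOnInterval_intervalIntegral left_mem_uIcc).fun_smul
    (hc 1)).fun_add ((him.absolutelyContinuousOnInterval_intervalIntegral left_mem_uIcc).fun_smul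
    (hc I))
  have key : ∀ x ∈ uIcc a b, ((∫ u in a..x, (f u).re) • (1 : ℂ) + (∫ u in a..x, (f u).im) • I) =
      ∫ u in a..x, f u := by
    intro x hx
    have hfx : IntervalIntegrable f volume a x := hf.mono_set (uIcc_subset_uIcc_left hx)
    apply Complex.ext
    · have := Complex.reCLM.intervalIntegral_comp_comm hfx
      simpa using this
    · have := Complex.imCLM.intervalIntegral_comp_comm hfx
      simpa using this
  rw [absolutelyContinuousOnInterval_iff] at h ⊢
  intro ε hε
  obtain ⟨δ, hδ, H⟩ := h ε hε
  refine ⟨δ, hδ, fun E hE hlt => ?_⟩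
  convert H E hE hlt using 3 with i hi
  · exact (key _ (hE.1 i hi).1).symm
  · exact (key _ (hE.1 i hi).2).symm

namespace IsPrimitive

variable {F G f g : ℝ → ℂ}

theorem intervalIntegral (hf : LocallyIntegrable f volume) (a : ℝ) :
    IsPrimitive (fun t => ∫ u in a..t, f u) f :=
  ⟨hf, fun s t => (intervalIntegral.integral_add_adjacent_intervals
    (hf.intervalIntegrable_real a s) (hf.intervalIntegrable_real s t)).symm⟩

theorem absolutelyContinuousOnInterval (h : IsPrimitive F f) (a b : ℝ) :
    AbsolutelyContinuousOnInterval F a b := by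
  have hc : AbsolutelyContinuousOnInterval (fun _ : ℝ => F a) a b :=
    contDiffOn_const.absolutelyContinuousOnInterval
  have := hc.fun_add (h.locallyIntegrable.intervalIntegrable_real a
    b).absolutelyContinuousOnInterval_intervalIntegral_complex
  rwa [← funext (h.eq_add_integral a)] at this

theorem continuous (h : IsPrimitive F f) : Continuous F := by
  rw [funext (h.eq_add_integral 0)]
  exact continuous_const.add
    (intervalIntegral.continuous_primitive h.locallyIntegrable.intervalIntegrable_real 0)

theorem ae_hasDerivAt (h : IsPrimitive F f) : ∀ᵐ x, HasDerivAt F (f x) x := by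
  filter_upwards [LocallyIntegrable.ae_hasDerivAt_integral h.locallyIntegrable] with x hx
  rw [funext (h.eq_add_integral 0)]
  exact (hx 0).const_add _

theorem of_absolutelyContinuousOnInterval (hF : ∀ a b, AbsolutelyContinuousOnInterval F a b)
    (hf : LocallyIntegrable f volume) (hd : ∀ᵐ x, HasDerivAt F (f x) x) : IsPrimitive F f := by
  refine ⟨hf, fun s t => ?_⟩
  have hP := intervalIntegral hf s
  obtain ⟨C, hC⟩ := ((hF s t).fun_sub
    (hP.absolutelyContinuousOnInterval s t)).const_of_ae_hasDerivAt_zero <| by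
      filter_upwards [hd, hP.ae_hasDerivAt] with x hx hx' _
      simpa using hx.fun_sub hx'
  have hs := hC s left_mem_uIcc
  have ht := hC t right_mem_uIcc
  simp only [intervalIntegral.integral_same, sub_zero] at hs
  rw [hs, ← ht]
  ring

theorem ofReal_of_contDiff {φ : ℝ → ℝ} (hφ : ContDiff ℝ 1 φ) :
    IsPrimitive (fun t => (φ t : ℂ)) (fun t => ((deriv φ t : ℝ) : ℂ)) :=
  of_absolutelyContinuousOnInterval
    (fun _ _ => (ofRealCLM.contDiff.comp hφ).contDiffOn.absolutelyContinuousOnInterval)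
    (continuous_ofReal.comp hφ.continuous_deriv_one).locallyIntegrable
    (ae_of_all _ fun x => (hφ.differentiable one_ne_zero x).hasDerivAt.ofReal_comp)

theorem mul (hF : IsPrimitive F f) (hG : IsPrimitive G g) :
    IsPrimitive (fun t => F t * G t) (fun t => f t * G t + F t * g t) := by
  refine of_absolutelyContinuousOnInterval (fun a b =>
    (hF.absolutelyContinuousOnInterval a b).fun_smul (hG.absolutelyContinuousOnInterval a b))
    ((hF.locallyIntegrable.mul_continuous hG.continuous).add ?_) ?_
  · simpa only [mul_comm] using hG.locallyIntegrable.mul_continuous hF.continuous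
  · filter_upwards [hF.ae_hasDerivAt, hG.ae_hasDerivAt] with x hx hx'
    exact hx.fun_mul hx'

theorem star (hF : IsPrimitive F f) : IsPrimitive (fun t => conj (F t)) (fun t => conj (f t)) := by
  refine ⟨hF.locallyIntegrable.conj, fun s t => ?_⟩
  have := Complex.conjCLE.toContinuousLinearMap.intervalIntegral_comp_comm
    (hF.locallyIntegrable.intervalIntegrable_real s t)
  simp only [ContinuousLinearEquiv.coe_coe, conjCLE_apply] at this
  rw [hF.eq_add_integral s t, map_add, this]

theorem congr_ae (hF : IsPrimitive F f) (hfg : f =ᵐ[volume] g) : IsPrimitive F g :=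
  ⟨hF.locallyIntegrable.congr hfg, fun s t => by
    rw [hF.eq_add_integral s t]
    congr 1
    exact intervalIntegral.integral_congr_ae (by filter_upwards [hfg] with x hx _ using hx)⟩

theorem integral_eq_zero (hF : IsPrimitive F f) (hiF : Integrable F) (hif : Integrable f) :
    ∫ t, f t = 0 := by
  have htop : Tendsto F atTop (𝓝 (F 0 + ∫ t in Ioi 0, f t)) := by
    rw [funext (hF.eq_add_integral 0)]
    simpa using
      (intervalIntegral_tendsto_integral_Ioi 0 hif.integrableOn tendsto_id).const_add (F 0)
  have hbot : Tendsto F atBot (𝓝 (F 0 - ∫ t in Iic 0, f t)) := by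
    have := (intervalIntegral_tendsto_integral_Iic 0 hif.integrableOn tendsto_id).const_sub (F 0)
    refine this.congr fun t => ?_
    rw [hF.eq_add_integral t 0, id, add_sub_cancel_right]
  have h1 := (hiF.integrableAtFilter atTop).eq_zero_of_tendsto (fun s hs => by
    obtain ⟨b, hb⟩ := mem_atTop_sets.1 hs
    rw [← top_le_iff, ← Real.volume_Ici (a := b)]
    exact measure_mono hb) htop
  have h2 := (hiF.integrableAtFilter atBot).eq_zero_of_tendsto (fun s hs => by
    obtain ⟨b, hb⟩ := mem_atBot_sets.1 hs
    rw [← top_le_iff, ← Real.volume_Iic (a := b)]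
    exact measure_mono hb) hbot
  rw [← intervalIntegral.integral_Iic_add_Ioi (b := 0) hif.integrableOn hif.integrableOn]
  linear_combination h1 - h2

end IsPrimitive

/-- A locally integrable function with vanishing weak derivative is a.e. constant. -/
theorem ae_eq_const_of_forall_integral_deriv_smul_eq_zero {f : ℝ → ℂ}
    (hf : LocallyIntegrable f volume)
    (h : ∀ φ : ℝ → ℝ, ContDiff ℝ ∞ φ → HasCompactSupport φ → ∫ t, deriv φ t • f t = 0) :
    ∃ C : ℂ, f =ᵐ[volume] fun _ => C := by
  let b : ContDiffBump (0 : ℝ) := default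
  let ρ : ℝ → ℝ := b.normed volume
  have hρ : ContDiff ℝ ∞ ρ := b.contDiff_normed
  have hρs : HasCompactSupport ρ := b.hasCompactSupport_normed
  have hρi : ∫ t, ρ t = 1 := b.integral_normed
  refine ⟨∫ t, ρ t • f t, ae_eq_of_integral_contDiff_smul_eq hf
    continuous_const.locallyIntegrable fun ψ hψ hψs => ?_⟩
  let θ : ℝ → ℝ := fun t => ψ t - (∫ u, ψ u) * ρ t
  have hθ : ContDiff ℝ ∞ θ := hψ.sub (contDiff_const.mul hρ)
  have hθs : HasCompactSupport θ := hψs.sub hρs.mul_left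
  have hψint := hψ.continuous.integrable_of_hasCompactSupport hψs (μ := volume)
  have hρint := hρ.continuous.integrable_of_hasCompactSupport hρs (μ := volume)
  have hθi : ∫ t, θ t = 0 := by
    rw [integral_sub hψint (hρint.const_mul _), integral_const_mul, hρi]
    ring
  obtain ⟨R, hR⟩ := hθs.isBounded.subset_closedBall 0
  have hout : ∀ t, R < |t| → θ t = 0 := fun t ht => image_eq_zero_of_notMem_tsupport fun hm => by
    have := hR hm
    rw [mem_closedBall_zero_iff, Real.norm_eq_abs] at this
    linarith
  let φ : ℝ → ℝ := fun t => ∫ u in (-(|R| + 1))..t, θ u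
  have hd : ∀ t, HasDerivAt φ (θ t) t := fun t =>
    intervalIntegral.integral_hasDerivAt_right (hθ.continuous.intervalIntegrable _ _)
      hθ.continuous.stronglyMeasurable.stronglyMeasurableAtFilter hθ.continuous.continuousAt
  have hφd : deriv φ = θ := funext fun t => (hd t).deriv
  have hφ : ContDiff ℝ ∞ φ :=
    contDiff_infty_iff_deriv.mpr ⟨fun t => (hd t).differentiableAt, hφd ▸ hθ⟩
  have hφs : HasCompactSupport φ := by
    refine HasCompactSupport.intro (isCompact_Icc (a := -(|R| + 1)) (b := |R| + 1)) fun t ht => ?_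
    have hRR := le_abs_self R
    have h0 := abs_nonneg R
    rcases lt_or_ge t (-(|R| + 1)) with h1 | h1
    · refine intervalIntegral.integral_zero_ae (ae_of_all _ fun u hu => hout u ?_)
      rw [uIoc_of_ge h1.le] at hu
      linarith [neg_le_abs u, hu.2]
    · have h2 : |R| + 1 < t := not_le.mp fun h2 => ht ⟨h1, h2⟩
      change ∫ u in (-(|R| + 1))..t, θ u = 0
      rw [intervalIntegral.integral_of_le h1, setIntegral_eq_integral_of_forall_compl_eq_zero, hθi]
      refine fun u hu => hout u ?_
      by_contra! hle
      have := abs_le.mp hle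
      exact hu ⟨by linarith, by linarith⟩
  have hz := h φ hφ hφs
  rw [hφd] at hz
  simp only [θ, sub_smul, mul_smul] at hz
  have hsub := integral_sub (hf.integrable_smul_left_of_hasCompactSupport hψ.continuous hψs)
    ((hf.integrable_smul_left_of_hasCompactSupport hρ.continuous hρs).fun_smul (∫ u, ψ u))
  rw [hz, integral_smul] at hsub
  rw [integral_smul_const, sub_eq_zero.mp hsub.symm]

/-- A locally integrable function whose weak derivative is locally integrable agrees a.e. with
an indefinite integral of its weak derivative. -/
theorem exists_isPrimitive_of_forall_integral_smul_eq {f g : ℝ → ℂ}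
    (hf : LocallyIntegrable f volume) (hg : LocallyIntegrable g volume)
    (h : ∀ φ : ℝ → ℝ, ContDiff ℝ ∞ φ → HasCompactSupport φ →
      ∫ t, deriv φ t • f t = - ∫ t, φ t • g t) :
    ∃ F : ℝ → ℂ, f =ᵐ[volume] F ∧ IsPrimitive F g := by
  have hP := IsPrimitive.intervalIntegral hg 0
  set P : ℝ → ℂ := fun t => ∫ u in (0 : ℝ)..t, g u
  obtain ⟨C, hC⟩ := ae_eq_const_of_forall_integral_deriv_smul_eq_zero
    (hf.sub hP.continuous.locallyIntegrable) fun φ hφ hφs => by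
      have hφ' : Continuous (deriv φ) := hφ.continuous_deriv (by simp)
      have hφc := IsPrimitive.ofReal_of_contDiff (hφ.of_le (by simp))
      have i1 := hP.continuous.locallyIntegrable.integrable_smul_left_of_hasCompactSupport
        hφ' hφs.deriv (μ := volume)
      have i2 := hg.integrable_smul_left_of_hasCompactSupport hφ.continuous hφs
      have i3 := hP.continuous.locallyIntegrable.integrable_smul_left_of_hasCompactSupport
        hφ.continuous hφs (μ := volume)
      have := (hφc.mul hP).integral_eq_zero (by simpa using i3) (by simpa using! i1.add i2)
      have e : ∫ t, deriv φ t • P t = - ∫ t, φ t • g t := by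
        rw [integral_add (by simpa using i1) (by simpa using i2)] at this
        simpa using eq_neg_of_add_eq_zero_left this
      simp only [Pi.sub_apply, smul_sub]
      rw [integral_sub (hf.integrable_smul_left_of_hasCompactSupport hφ' hφs.deriv) i1, h φ hφ hφs,
        e, sub_self]
  refine ⟨fun t => C + P t, ?_, hg, fun s t => ?_⟩
  · filter_upwards [hC] with t ht
    rw [← ht, Pi.sub_apply, sub_add_cancel]
  · rw [hP.eq_add_integral s t, add_assoc]

section Weighted

variable {c : ℝ}

theorem ae_weightedMeasure (c : ℝ) : ae (weightedMeasure c) = ae volume := by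
  refine le_antisymm (withDensity_absolutelyContinuous _ _).ae_le
    (withDensity_absolutelyContinuous' (by fun_prop) (ae_of_all _ fun t => ?_)).ae_le
  simpa using Real.exp_pos _

instance isLocallyFiniteMeasure_weightedMeasure (c : ℝ) :
    IsLocallyFiniteMeasure (weightedMeasure c) :=
  IsLocallyFiniteMeasure.withDensity_ofReal (by fun_prop)

theorem integrable_weightedMeasure_iff {f : ℝ → ℂ} :
    Integrable f (weightedMeasure c) ↔
      Integrable fun t => (Real.exp (-2 * c * t) : ℂ) * f t := by
  rw [weightedMeasure, integrable_withDensity_iff_integrable_smul' (by fun_prop) (by simp)]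
  simp only [ENNReal.toReal_ofReal (Real.exp_pos _).le, real_smul]

theorem integral_weightedMeasure (f : ℝ → ℂ) :
    ∫ t, f t ∂weightedMeasure c = ∫ t, (Real.exp (-2 * c * t) : ℂ) * f t := by
  rw [weightedMeasure, integral_withDensity_eq_integral_toReal_smul (by fun_prop) (by simp)]
  simp only [ENNReal.toReal_ofReal (Real.exp_pos _).le, real_smul]

theorem locallyIntegrable_of_weightedMeasure {f : ℝ → ℂ}
    (hf : LocallyIntegrable f (weightedMeasure c)) : LocallyIntegrable f volume := by
  refine locallyIntegrable_iff.mpr fun K hK => ?_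
  have h := hf.integrableOn_isCompact hK
  rw [IntegrableOn, weightedMeasure, restrict_withDensity hK.measurableSet,
    integrable_withDensity_iff_integrable_smul' (by fun_prop) (by simp)] at h
  have h' : IntegrableOn (fun t => (Real.exp (2 * c * t)) •
      ((ENNReal.ofReal (Real.exp (-2 * c * t))).toReal • f t)) K volume :=
    IntegrableOn.continuousOn_smul h (by fun_prop) hK
  refine h'.congr (ae_of_all _ fun t => ?_)
  simp only [ENNReal.toReal_ofReal (Real.exp_pos _).le, smul_smul, ← Real.exp_add]
  simp

theorem locallyIntegrable_lp_weightedMeasure (f : Lp ℂ 2 (weightedMeasure c)) :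
    LocallyIntegrable f volume :=
  locallyIntegrable_of_weightedMeasure ((Lp.memLp f).locallyIntegrable one_le_two)

theorem inner_lp_weightedMeasure (f g : Lp ℂ 2 (weightedMeasure c)) :
    inner ℂ f g = ∫ t, (Real.exp (-2 * c * t) : ℂ) * (conj (f t) * g t) := by
  rw [L2.inner_def, integral_weightedMeasure]
  simp only [RCLike.inner_apply']

theorem integrable_inner_lp_weightedMeasure (f g : Lp ℂ 2 (weightedMeasure c)) :
    Integrable fun t => (Real.exp (-2 * c * t) : ℂ) * (conj (f t) * g t) := by
  have := integrable_weightedMeasure_iff.mp (L2.integrable_inner (𝕜 := ℂ) f g)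
  simpa only [RCLike.inner_apply'] using this

theorem isPrimitive_exp (a : ℝ) :
    IsPrimitive (fun t => (Real.exp (a * t) : ℂ)) (fun t => a * (Real.exp (a * t) : ℂ)) := by
  convert IsPrimitive.ofReal_of_contDiff (φ := fun t => Real.exp (a * t)) (by fun_prop) using 2
    with t
  have := ((hasDerivAt_id' t).const_mul a).exp
  rw [this.deriv]
  push_cast
  ring

/-- Integration by parts in `L²(ℝ, e^{-2ct} dt)`. -/
theorem inner_add_inner_eq_of_isPrimitive {f f' g g' : Lp ℂ 2 (weightedMeasure c)} {F G : ℝ → ℂ}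
    (hfF : f =ᵐ[weightedMeasure c] F) (hF : IsPrimitive F f')
    (hgG : g =ᵐ[weightedMeasure c] G) (hG : IsPrimitive G g') :
    inner ℂ f' g + inner ℂ f g' = 2 * c * inner ℂ f g := by
  rw [ae_weightedMeasure] at hfF hgG
  have i1 := integrable_inner_lp_weightedMeasure f' g
  have i2 := integrable_inner_lp_weightedMeasure f g'
  have i0 := integrable_inner_lp_weightedMeasure f g
  have hP := (isPrimitive_exp (-2 * c)).mul (hF.star.mul hG)
  have h := (hP.congr_ae (g := fun t => ((Real.exp (-2 * c * t) : ℂ) * (conj (f' t) * g t) +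
      (Real.exp (-2 * c * t) : ℂ) * (conj (f t) * g' t)) -
      2 * c * ((Real.exp (-2 * c * t) : ℂ) * (conj (f t) * g t))) (by
    filter_upwards [hfF, hgG] with t h1 h2
    rw [h1, h2]
    push_cast
    ring)).integral_eq_zero (i0.congr (by
      filter_upwards [hfF, hgG] with t h1 h2
      rw [h1, h2])) ((i1.add i2).sub (i0.const_mul _))
  have hsub := integral_sub (i1.add i2) (i0.const_mul (2 * c))
  simp only [Pi.add_apply] at hsub
  rw [hsub, integral_add i1 i2, integral_const_mul,
    ← inner_lp_weightedMeasure, ← inner_lp_weightedMeasure, ← inner_lp_weightedMeasure] at h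
  exact sub_eq_zero.mp h

end Weighted

namespace IsInfinitesimalShift

variable {c : ℝ} {A : Lp ℂ 2 (weightedMeasure c) →ₗ.[ℂ] Lp ℂ 2 (weightedMeasure c)}

theorem exists_apply_eq_iff (hA : IsInfinitesimalShift c A) (f g : Lp ℂ 2 (weightedMeasure c)) :
    (∃ hf : f ∈ A.domain, A ⟨f, hf⟩ = g) ↔
      ∃ F : ℝ → ℂ, f =ᵐ[weightedMeasure c] F ∧ IsPrimitive F g :=
  (hA.2 f g).trans <| exists_congr fun _ => and_congr_right fun _ =>
    ⟨fun h => ⟨locallyIntegrable_lp_weightedMeasure g, h⟩, fun h => h.eq_add_integral⟩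

theorem inner_apply_add_inner_apply (hA : IsInfinitesimalShift c A) (f g : A.domain) :
    inner ℂ (A f) (g : Lp ℂ 2 (weightedMeasure c)) +
      inner ℂ (f : Lp ℂ 2 (weightedMeasure c)) (A g) =
      2 * c * inner ℂ (f : Lp ℂ 2 (weightedMeasure c)) (g : Lp ℂ 2 (weightedMeasure c)) := by
  obtain ⟨F, hfF, hF⟩ := (hA.exists_apply_eq_iff f (A f)).mp ⟨f.2, rfl⟩
  obtain ⟨G, hgG, hG⟩ := (hA.exists_apply_eq_iff g (A g)).mp ⟨g.2, rfl⟩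
  exact inner_add_inner_eq_of_isPrimitive hfF hF hgG hG

theorem inner_smul_sub_apply (hA : IsInfinitesimalShift c A) (f g : A.domain) :
    inner ℂ (((2 * c : ℝ) : ℂ) • (f : Lp ℂ 2 (weightedMeasure c)) - A f)
      (g : Lp ℂ 2 (weightedMeasure c)) = inner ℂ (f : Lp ℂ 2 (weightedMeasure c)) (A g) := by
  have h := hA.inner_apply_add_inner_apply f g
  rw [inner_sub_left, inner_smul_left, conj_ofReal]
  push_cast
  linear_combination -h

theorem norm_smul_sub_apply (hA : IsInfinitesimalShift c A) (f : A.domain) :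
    ‖((2 * c : ℝ) : ℂ) • (f : Lp ℂ 2 (weightedMeasure c)) - A f‖ = ‖A f‖ := by
  have h := hA.inner_apply_add_inner_apply f f
  have hre := congrArg re h
  rw [add_re, ← inner_conj_symm, conj_re, inner_self_eq_norm_sq_to_K] at hre
  have hr : (inner ℂ (f : Lp ℂ 2 (weightedMeasure c)) (A f)).re =
      c * ‖(f : Lp ℂ 2 (weightedMeasure c))‖ ^ 2 := by
    norm_cast at hre
    simp only [coe_algebraMap, ← ofReal_mul, ofReal_re, Submodule.coe_norm] at hre
    linarith
  rw [← sq_eq_sq₀ (norm_nonneg _) (norm_nonneg _), norm_sub_sq (𝕜 := ℂ), inner_smul_left,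
    conj_ofReal, norm_smul, RCLike.re_eq_complex_re, re_ofReal_mul, hr, mul_pow, norm_real,
    Real.norm_eq_abs, sq_abs]
  ring

/-- A smooth compactly supported function lies in the domain of `∂_c`. -/
theorem exists_apply_toLp_eq (hA : IsInfinitesimalShift c A) {φ : ℝ → ℝ} (hφ : ContDiff ℝ ∞ φ)
    (hφs : HasCompactSupport φ) :
    ∃ f : A.domain, ((f : Lp ℂ 2 (weightedMeasure c)) =ᵐ[volume] fun t => (φ t : ℂ)) ∧
      (A f =ᵐ[volume] fun t => ((deriv φ t : ℝ) : ℂ)) := by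
  have hφ' : Continuous (deriv φ) := hφ.continuous_deriv (by simp)
  have hφc := IsPrimitive.ofReal_of_contDiff (hφ.of_le (by simp))
  have m : MemLp (fun t => (φ t : ℂ)) 2 (weightedMeasure c) :=
    (continuous_ofReal.comp hφ.continuous).memLp_of_hasCompactSupport
      (hφs.comp_left (g := ofReal) ofReal_zero)
  have m' : MemLp (fun t => ((deriv φ t : ℝ) : ℂ)) 2 (weightedMeasure c) :=
    (continuous_ofReal.comp hφ').memLp_of_hasCompactSupport
      (hφs.deriv.comp_left (g := ofReal) ofReal_zero)
  have e' := m'.coeFn_toLp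
  rw [ae_weightedMeasure] at e'
  obtain ⟨hf, hAf⟩ := (hA.exists_apply_eq_iff (m.toLp _) (m'.toLp _)).mpr
    ⟨_, m.coeFn_toLp, hφc.congr_ae e'.symm⟩
  refine ⟨⟨_, hf⟩, ?_, hAf ▸ e'⟩
  have e := m.coeFn_toLp
  rwa [ae_weightedMeasure] at e

/-- The adjoint of `∂_c` is contained in `2c - ∂_c`. -/
theorem exists_apply_eq_of_forall_inner_eq (hA : IsInfinitesimalShift c A)
    {y z : Lp ℂ 2 (weightedMeasure c)}
    (h : ∀ f : A.domain, inner ℂ z (f : Lp ℂ 2 (weightedMeasure c)) = inner ℂ y (A f)) :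
    ∃ hy : y ∈ A.domain, A ⟨y, hy⟩ = ((2 * c : ℝ) : ℂ) • y - z := by
  have hw : Continuous fun t : ℝ => (Real.exp (-2 * c * t) : ℂ) := (isPrimitive_exp _).continuous
  have hyl := (locallyIntegrable_lp_weightedMeasure y).conj.mul_continuous hw
  have hzl := (locallyIntegrable_lp_weightedMeasure z).conj.mul_continuous hw
  obtain ⟨G, hyG, hG⟩ := exists_isPrimitive_of_forall_integral_smul_eq hyl hzl.neg
    fun φ hφ hφs => by
      obtain ⟨f, hf, hf'⟩ := hA.exists_apply_toLp_eq hφ hφs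
      have hφf := h f
      rw [inner_lp_weightedMeasure, inner_lp_weightedMeasure] at hφf
      have e1 : ∫ t, φ t • (conj (z t) * (Real.exp (-2 * c * t) : ℂ)) =
          ∫ t, (Real.exp (-2 * c * t) : ℂ) *
            (conj (z t) * (f : Lp ℂ 2 (weightedMeasure c)) t) := by
        refine integral_congr_ae ?_
        filter_upwards [hf] with t ht
        rw [ht, real_smul]
        ring
      have e2 : ∫ t, deriv φ t • (conj (y t) * (Real.exp (-2 * c * t) : ℂ)) =
          ∫ t, (Real.exp (-2 * c * t) : ℂ) * (conj (y t) * A f t) := by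
        refine integral_congr_ae ?_
        filter_upwards [hf'] with t ht
        rw [ht, real_smul]
        ring
      simp only [Pi.neg_apply, smul_neg, integral_neg, neg_neg]
      rw [e1, e2, hφf]
  have hexp : ∀ t : ℝ, (Real.exp (-2 * c * t) : ℂ) * (Real.exp (2 * c * t) : ℂ) = 1 := fun t => by
    rw [← ofReal_mul, ← Real.exp_add]
    simp
  have hH := hG.star.mul (isPrimitive_exp (2 * c))
  have hyH : ∀ᵐ t, y t = conj (G t) * (Real.exp (2 * c * t) : ℂ) := by
    filter_upwards [hyG] with t ht
    rw [← ht, map_mul, conj_conj, conj_ofReal, mul_assoc, hexp, mul_one]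
  refine (hA.exists_apply_eq_iff _ _).mpr ⟨_, by rwa [EventuallyEq, ae_weightedMeasure],
    hH.congr_ae ?_⟩
  have h1 := Lp.coeFn_sub (((2 * c : ℝ) : ℂ) • y) z
  have h2 := Lp.coeFn_smul ((2 * c : ℝ) : ℂ) y
  rw [ae_weightedMeasure] at h1 h2
  filter_upwards [h1, h2, hyH] with t h1 h2 h3
  rw [h1, Pi.sub_apply, h2, Pi.smul_apply, smul_eq_mul, Pi.neg_apply, map_neg, map_mul, conj_conj,
    conj_ofReal, h3]
  linear_combination -z t * hexp t

theorem mem_adjoint_domain (hA : IsInfinitesimalShift c A) (f : A.domain) :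
    (f : Lp ℂ 2 (weightedMeasure c)) ∈ A.adjoint.domain :=
  LinearPMap.mem_adjoint_domain_of_exists _ ⟨_, hA.inner_smul_sub_apply f⟩

theorem adjoint_apply (hA : IsInfinitesimalShift c A) (f : A.domain) :
    A.adjoint ⟨f, hA.mem_adjoint_domain f⟩ =
      ((2 * c : ℝ) : ℂ) • (f : Lp ℂ 2 (weightedMeasure c)) - A f :=
  LinearPMap.adjoint_apply_eq hA.1 _ (hA.inner_smul_sub_apply f)

theorem exists_apply_eq_of_adjoint (hA : IsInfinitesimalShift c A) (y : A.adjoint.domain) :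
    ∃ hy : (y : Lp ℂ 2 (weightedMeasure c)) ∈ A.domain,
      A ⟨y, hy⟩ = ((2 * c : ℝ) : ℂ) • (y : Lp ℂ 2 (weightedMeasure c)) - A.adjoint y :=
  hA.exists_apply_eq_of_forall_inner_eq (LinearPMap.adjoint_isFormalAdjoint hA.1 y)

theorem isClosed (hA : IsInfinitesimalShift c A) : A.IsClosed := by
  have h : (A.graph : Set (Lp ℂ 2 (weightedMeasure c) × Lp ℂ 2 (weightedMeasure c))) =
      (fun p => (p.1, ((2 * c : ℝ) : ℂ) • p.1 - p.2)) ⁻¹' A.adjoint.graph := by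
    ext ⟨f, g⟩
    simp only [SetLike.mem_coe, mem_preimage, LinearPMap.mem_graph_iff]
    constructor
    · rintro ⟨f, rfl, rfl⟩
      exact ⟨⟨f, hA.mem_adjoint_domain f⟩, rfl, hA.adjoint_apply f⟩
    · rintro ⟨y, rfl, hy⟩
      obtain ⟨hyd, e⟩ := hA.exists_apply_eq_of_adjoint y
      exact ⟨⟨y, hyd⟩, rfl, by rw [e, hy, sub_sub_cancel]⟩
  rw [LinearPMap.IsClosed, h]
  exact (LinearPMap.adjoint_isClosed hA.1).preimage (by fun_prop)

/-- The indicator of `[0, 1]` has no continuous representative. -/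
theorem exists_notMem_domain (hA : IsInfinitesimalShift c A) :
    ∃ f : Lp ℂ 2 (weightedMeasure c), f ∉ A.domain := by
  have hμ : weightedMeasure c (Icc 0 1) ≠ ⊤ := isCompact_Icc.measure_lt_top.ne
  refine ⟨indicatorConstLp 2 measurableSet_Icc hμ 1, fun hf => ?_⟩
  obtain ⟨F, hfF, hF⟩ := (hA.exists_apply_eq_iff _ _).mp ⟨hf, rfl⟩
  have hFi := hfF.symm.trans indicatorConstLp_coeFn
  rw [ae_weightedMeasure] at hFi
  have h1 : EqOn F (fun _ => 1) (Icc 0 1) := by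
    refine Measure.eqOn_Icc_of_ae_eq volume zero_ne_one ?_ hF.continuous.continuousOn
      continuousOn_const
    refine (ae_restrict_iff' measurableSet_Icc).mpr ?_
    filter_upwards [hFi] with t ht htm
    rw [ht, indicator_of_mem htm]
  have h2 : EqOn F (fun _ => 0) (Ici 1) := by
    have h3 : EqOn F (fun _ => 0) (Ioi 1) := by
      refine Measure.eqOn_open_of_ae_eq (μ := volume) ?_ isOpen_Ioi hF.continuous.continuousOn
        continuousOn_const
      refine (ae_restrict_iff' measurableSet_Ioi).mpr ?_
      filter_upwards [hFi] with t ht htm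
      rw [ht, indicator_of_notMem fun h => not_le.mpr htm h.2]
    simpa using h3.closure hF.continuous continuous_const
  exact one_ne_zero ((h1 (right_mem_Icc.mpr zero_le_one)).symm.trans (h2 self_mem_Ici))

end IsInfinitesimalShift

/-- A closed densely defined operator that is bounded on its domain is everywhere defined. -/
theorem LinearPMap.IsClosed.domain_eq_top_of_bound {E E' : Type*} [NormedAddCommGroup E]
    [NormedSpace ℂ E] [NormedAddCommGroup E'] [NormedSpace ℂ E'] [CompleteSpace E']
    {A : E →ₗ.[ℂ] E'} (hA : A.IsClosed) (hd : Dense (A.domain : Set E)) {C : ℝ}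
    (hC : ∀ f : A.domain, ‖A f‖ ≤ C * ‖(f : E)‖) : A.domain = ⊤ := by
  refine Submodule.eq_top_iff'.mpr fun f => ?_
  obtain ⟨u, hu, hlim⟩ := mem_closure_iff_seq_limit.mp (hd f)
  let v : ℕ → A.domain := fun n => ⟨u n, hu n⟩
  let T : A.domain →L[ℂ] E' := A.toFun.mkContinuous C hC
  have hv : CauchySeq v :=
    isUniformEmbedding_subtype_val.isUniformInducing.cauchy_map_iff.mp hlim.cauchySeq
  obtain ⟨g, hg⟩ := cauchySeq_tendsto_of_complete (T.uniformContinuous.comp_cauchySeq hv)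
  have hmem : (f, g) ∈ A.graph := by
    refine hA.mem_of_tendsto (hlim.prodMk_nhds hg) (Eventually.of_forall fun n => ?_)
    exact A.mem_graph (v n)
  exact LinearPMap.mem_domain_of_mem_graph hmem

end

/-- For `c ≥ 0`, the infinitesimal shift `∂_c` is an unbounded normal operator on
`ℍ_c = L²(ℝ, e^{-2ct}dt)` (closed, densely defined, with `‖∂_c f‖ = ‖∂_c* f‖` on the common
domain), and its adjoint is `∂_c* = 2c − ∂_c` with `D(∂_c*) = D(∂_c)`. -/
theorem infinitesimalShift_normal_adjoint (c : ℝ) (hc : 0 ≤ c)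
    (A : Lp ℂ 2 (weightedMeasure c) →ₗ.[ℂ] Lp ℂ 2 (weightedMeasure c))
    (hA : IsInfinitesimalShift c A) :
    (¬ ∃ C : ℝ, ∀ f : A.domain, ‖A f‖ ≤ C * ‖(f : Lp ℂ 2 (weightedMeasure c))‖) ∧
    A.IsClosed ∧ Dense (A.domain : Set (Lp ℂ 2 (weightedMeasure c))) ∧
    A.adjoint.domain = A.domain ∧
    ∀ f : A.domain, ∃ hf : (f : Lp ℂ 2 (weightedMeasure c)) ∈ A.adjoint.domain,
      A.adjoint ⟨(f : Lp ℂ 2 (weightedMeasure c)), hf⟩ =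
          ((2 * c : ℝ) : ℂ) • (f : Lp ℂ 2 (weightedMeasure c)) - A f ∧
      ‖A.adjoint ⟨(f : Lp ℂ 2 (weightedMeasure c)), hf⟩‖ = ‖A f‖ := by
  have hcl := hA.isClosed
  refine ⟨?_, hcl, hA.1, ?_, fun f => ⟨hA.mem_adjoint_domain f, hA.adjoint_apply f, ?_⟩⟩
  · rintro ⟨C, hC⟩
    obtain ⟨f, hf⟩ := hA.exists_notMem_domain
    exact hf (hcl.domain_eq_top_of_bound hA.1 hC ▸ Submodule.mem_top)
  · exact le_antisymm (fun y hy => (hA.exists_apply_eq_of_adjoint ⟨y, hy⟩).1)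
      fun f hf => hA.mem_adjoint_domain ⟨f, hf⟩
  · rw [hA.adjoint_apply f, hA.norm_smul_sub_apply f]
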